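/- For every k ≥ 2, CPDL(TWₖ) is strictly less expressive than CPDL(TW_{k+1}): CPDL(TWₖ) ≤ CPDL(TW_{k+1}), and there is a CPDL(TW_{k+1}) formula not equivalent to any CPDL(TWₖ) formula. -/

import Mathlib

set_option linter.unusedVariables false

/-! ## Kripke structures -/

/-- A Kripke structure with worlds `W`, atomic propositions `P` and atomic programs `A`. -/
structure Kripke (W P A : Type) where
  rel : A → W → W → Prop
  val : P → W → Prop

/-! ## Syntax of `CPDL+` with loop and intersection (master language) -/

mutual
  /-- Formulas of loop/intersection CPDL+:  `p | ¬φ | φ∧φ | ⟨π⟩ | loop(π)`. -/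
  inductive PDLFormula : Type where
    | prop  : ℕ → PDLFormula
    | neg   : PDLFormula → PDLFormula
    | conj  : PDLFormula → PDLFormula → PDLFormula
    | diam  : PDLProgram → PDLFormula
    | floop : PDLProgram → PDLFormula
  /-- Programs: `ε | a | ā | π∪π | π∘π | π* | φ? | π∩π | C[x_s,x_t]`. -/
  inductive PDLProgram : Type where
    | eps    : PDLProgram
    | atom   : ℕ → PDLProgram
    | conv   : ℕ → PDLProgram
    | punion : PDLProgram → PDLProgram → PDLProgram
    | comp   : PDLProgram → PDLProgram → PDLProgram
    | star   : PDLProgram → PDLProgram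
    | test   : PDLFormula → PDLProgram
    | inter  : PDLProgram → PDLProgram → PDLProgram
    | cprog  : AtomList → ℕ → ℕ → PDLProgram
  /-- A finite list of atoms `π(x,y)` (a "conjunctive program body" `C`). -/
  inductive AtomList : Type where
    | nil   : AtomList
    | acons : PDLProgram → ℕ → ℕ → AtomList → AtomList
end

/-! ## Semantics -/

mutual
  /-- Satisfaction `⟦φ⟧_K ⊆ W`. -/
  def PDLFormula.sat {W : Type} (K : Kripke W ℕ ℕ) : PDLFormula → W → Prop
    | .prop p, w => K.val p w
    | .neg φ, w => ¬ PDLFormula.sat K φ w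
    | .conj φ ψ, w => PDLFormula.sat K φ w ∧ PDLFormula.sat K ψ w
    | .diam π, w => ∃ v, PDLProgram.rel K π w v
    | .floop π, w => PDLProgram.rel K π w w
  termination_by φ _ => sizeOf φ
  /-- Binary relation `⟦π⟧_K ⊆ W × W`. -/
  def PDLProgram.rel {W : Type} (K : Kripke W ℕ ℕ) : PDLProgram → W → W → Prop
    | .eps, u, v => u = v
    | .atom a, u, v => K.rel a u v
    | .conv a, u, v => K.rel a v u
    | .punion π ρ, u, v => PDLProgram.rel K π u v ∨ PDLProgram.rel K ρ u v
    | .comp π ρ, u, v => ∃ w, PDLProgram.rel K π u w ∧ PDLProgram.rel K ρ w v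
    | .star π, u, v => Relation.ReflTransGen (fun a b => PDLProgram.rel K π a b) u v
    | .test φ, u, v => u = v ∧ PDLFormula.sat K φ u
    | .inter π ρ, u, v => PDLProgram.rel K π u v ∧ PDLProgram.rel K ρ u v
    | .cprog C xs xt, u, v => ∃ f : ℕ → W, f xs = u ∧ f xt = v ∧ AtomList.sat K C f
  termination_by π _ _ => sizeOf π
  /-- `f` is a `C`-satisfying assignment. -/
  def AtomList.sat {W : Type} (K : Kripke W ℕ ℕ) : AtomList → (ℕ → W) → Prop
    | .nil, _ => True
    | .acons π x y C, f => PDLProgram.rel K π (f x) (f y) ∧ AtomList.sat K C f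
  termination_by C _ => sizeOf C
end

/-- Semantic equivalence of formulas (on every Kripke structure). -/
def FormEquiv (φ ψ : PDLFormula) : Prop :=
  ∀ (W : Type) (K : Kripke W ℕ ℕ) (w : W), φ.sat K w ↔ ψ.sat K w

/-- Semantic equivalence of programs (on every Kripke structure). -/
def ProgEquiv (π ρ : PDLProgram) : Prop :=
  ∀ (W : Type) (K : Kripke W ℕ ℕ) (u v : W), π.rel K u v ↔ ρ.rel K u v

/-! ## Graphs (undirected, possibly with self-loops), tree decompositions -/

/-- An undirected graph (self-loop edges are allowed; `adj` is intended symmetric). -/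
structure UGraph (V : Type) where
  verts : Set V
  adj : V → V → Prop

/-- Connectedness of a graph. -/
def UGraph.Connected {V : Type} (G : UGraph V) : Prop :=
  G.verts.Nonempty ∧ ∀ x ∈ G.verts, ∀ y ∈ G.verts, Relation.ReflTransGen G.adj x y

/-- Graph isomorphism (between graphs on possibly different vertex types). -/
def UGraph.Iso {V V' : Type} (G : UGraph V) (H : UGraph V') : Prop :=
  ∃ f : V → V', Set.BijOn f G.verts H.verts ∧
    ∀ x ∈ G.verts, ∀ y ∈ G.verts, (G.adj x y ↔ H.adj (f x) (f y))

/-- A tree decomposition of a (possibly infinite) graph. -/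
structure TreeDecomp {V : Type} (G : UGraph V) where
  ι : Type
  T : SimpleGraph ι
  isTree : T.IsTree
  bag : ι → Set V
  cov_vert : ∀ v ∈ G.verts, ∃ b, v ∈ bag b
  cov_edge : ∀ x y, G.adj x y → ∃ b, x ∈ bag b ∧ y ∈ bag b
  conn : ∀ (v : V) (b b' : ι), v ∈ bag b → v ∈ bag b' →
    Relation.ReflTransGen (fun c c' => T.Adj c c' ∧ v ∈ bag c ∧ v ∈ bag c') b b'

/-- The decomposition has width ≤ k (all bags have at most k+1 elements). -/
def TreeDecomp.WidthLE {V : Type} {G : UGraph V} (td : TreeDecomp G) (k : ℕ) : Prop :=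
  ∀ b, (td.bag b).Finite ∧ (td.bag b).ncard ≤ k + 1

/-- The graph has tree-width ≤ k. -/
def UGraph.TreewidthLE {V : Type} (G : UGraph V) (k : ℕ) : Prop :=
  ∃ td : TreeDecomp G, td.WidthLE k

/-- `TWₖ`: the class of finite graphs of tree-width at most `k`. -/
def TWClass (k : ℕ) : Set (UGraph ℕ) :=
  {G | G.verts.Finite ∧ G.TreewidthLE k}

/-! ## Underlying graphs of conjunctive programs, fragments -/

/-- The list of atoms `(π, x, y)` of `C`. -/
def AtomList.toList : AtomList → List (PDLProgram × ℕ × ℕ)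
  | .nil => []
  | .acons π x y C => (π, x, y) :: C.toList

/-- The variables occurring in `C`. -/
def AtomList.vars (C : AtomList) : Set ℕ :=
  {z | ∃ e ∈ C.toList, z = e.2.1 ∨ z = e.2.2}

/-- The underlying graph `G_C` of a set of atoms `C`. -/
def AtomList.graphC (C : AtomList) : UGraph ℕ where
  verts := C.vars
  adj x y := ∃ e ∈ C.toList, (x = e.2.1 ∧ y = e.2.2) ∨ (x = e.2.2 ∧ y = e.2.1)

/-- The underlying graph `G_{C[x_s,x_t]}`: `G_C` together with the edge `{x_s,x_t}`. -/
def cprogGraph (C : AtomList) (xs xt : ℕ) : UGraph ℕ where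
  verts := C.vars
  adj x y := C.graphC.adj x y ∨ (x = xs ∧ y = xt) ∨ (x = xt ∧ y = xs)

mutual
  /-- Syntactic fragment predicate: `L` allows `loop`, `I` allows `∩`, `N` allows `¬`,
  and every conjunctive program must be well-formed with underlying graph in
  (isomorphic to a member of) the class `𝒢`. -/
  def PDLFormula.OK (L I N : Bool) (𝒢 : Set (UGraph ℕ)) : PDLFormula → Prop
    | .prop _ => True
    | .neg φ => N = true ∧ PDLFormula.OK L I N 𝒢 φ
    | .conj φ ψ => PDLFormula.OK L I N 𝒢 φ ∧ PDLFormula.OK L I N 𝒢 ψ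
    | .diam π => PDLProgram.OK L I N 𝒢 π
    | .floop π => L = true ∧ PDLProgram.OK L I N 𝒢 π
  def PDLProgram.OK (L I N : Bool) (𝒢 : Set (UGraph ℕ)) : PDLProgram → Prop
    | .eps => True
    | .atom _ => True
    | .conv _ => True
    | .punion π ρ => PDLProgram.OK L I N 𝒢 π ∧ PDLProgram.OK L I N 𝒢 ρ
    | .comp π ρ => PDLProgram.OK L I N 𝒢 π ∧ PDLProgram.OK L I N 𝒢 ρ
    | .star π => PDLProgram.OK L I N 𝒢 π
    | .test φ => PDLFormula.OK L I N 𝒢 φ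
    | .inter π ρ => I = true ∧ PDLProgram.OK L I N 𝒢 π ∧ PDLProgram.OK L I N 𝒢 ρ
    | .cprog C xs xt =>
        xs ∈ C.vars ∧ xt ∈ C.vars ∧ (C.graphC).Connected ∧
        (∃ H ∈ 𝒢, (cprogGraph C xs xt).Iso H) ∧ AtomList.OK L I N 𝒢 C
  def AtomList.OK (L I N : Bool) (𝒢 : Set (UGraph ℕ)) : AtomList → Prop
    | .nil => True
    | .acons π _ _ C => PDLProgram.OK L I N 𝒢 π ∧ AtomList.OK L I N 𝒢 C
end

/-- The class of all graphs (no restriction on conjunctive programs). -/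
def FullClass : Set (UGraph ℕ) := Set.univ

/-- The single-vertex graph with a self-loop. -/
def loopGraph : UGraph ℕ := ⟨{0}, fun x y => x = 0 ∧ y = 0⟩

/-- The two-vertex graph with one edge. -/
def capGraph : UGraph ℕ := ⟨{0, 1}, fun x y => (x = 0 ∧ y = 1) ∨ (x = 1 ∧ y = 0)⟩

def GraphLoopClass : Set (UGraph ℕ) := {loopGraph}
def GraphCapClass : Set (UGraph ℕ) := {capGraph}

/-- `CPDL+` formulas: no loop, no intersection, arbitrary conjunctive programs. -/
def IsCPDLPlusFormula (φ : PDLFormula) : Prop := PDLFormula.OK false false true FullClass φ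
def IsCPDLPlusProgram (π : PDLProgram) : Prop := PDLProgram.OK false false true FullClass π
/-- `ICPDL+` formulas: intersection plus arbitrary conjunctive programs. -/
def IsICPDLPlusFormula (φ : PDLFormula) : Prop := PDLFormula.OK false true true FullClass φ
def IsICPDLPlusProgram (π : PDLProgram) : Prop := PDLProgram.OK false true true FullClass π
/-- `ICPDL` formulas: intersection, no conjunctive programs. -/
def IsICPDLFormula (φ : PDLFormula) : Prop := PDLFormula.OK false true true ∅ φ
def IsICPDLProgram (π : PDLProgram) : Prop := PDLProgram.OK false true true ∅ π

/-! ## Underlying graph / tree-width of Kripke structures -/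

/-- `u` is at distance ≤ 1 from `v` in (the underlying undirected graph of) `K`. -/
def Kripke.Near {W P A : Type} (K : Kripke W P A) (u v : W) : Prop :=
  u = v ∨ ∃ a, K.rel a u v ∨ K.rel a v u

/-- The underlying undirected graph of a Kripke structure. -/
def Kripke.graph {W P A : Type} (K : Kripke W P A) : UGraph W :=
  ⟨Set.univ, fun u v => ∃ a, K.rel a u v ∨ K.rel a v u⟩

/-- A Kripke structure has tree-width ≤ k. -/
def Kripke.TreewidthLE {W P A : Type} (K : Kripke W P A) (k : ℕ) : Prop :=
  K.graph.TreewidthLE k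

/-- Every world has finitely many neighbours at distance ≤ 1. -/
def Kripke.FiniteDegree {W P A : Type} (K : Kripke W P A) : Prop :=
  ∀ u : W, {v | K.Near u v}.Finite


/-! ## Proof -/

/-- Build an atom list from a list. -/
def atomsOfList : List (PDLProgram × ℕ × ℕ) → AtomList
  | [] => .nil
  | e :: l => .acons e.1 e.2.1 e.2.2 (atomsOfList l)

theorem toList_atomsOfList (l : List (PDLProgram × ℕ × ℕ)) : (atomsOfList l).toList = l := by
  induction l with
  | nil => rfl
  | cons e l ih => simp [atomsOfList, AtomList.toList, ih]

theorem atomList_sat_iff {W : Type} (K : Kripke W ℕ ℕ) (f : ℕ → W) : ∀ C : AtomList,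
    C.sat K f ↔ ∀ e ∈ C.toList, e.1.rel K (f e.2.1) (f e.2.2)
  | .nil => by simp [AtomList.sat, AtomList.toList]
  | .acons π x y C => by
    simp [AtomList.sat, AtomList.toList, atomList_sat_iff K f C]

theorem atomList_OK_atomsOfList (𝒢 : Set (UGraph ℕ)) (l : List (PDLProgram × ℕ × ℕ))
    (h : ∀ e ∈ l, e.1.OK false false true 𝒢) : (atomsOfList l).OK false false true 𝒢 := by
  induction l with
  | nil => simp [atomsOfList, AtomList.OK]
  | cons e l ih =>
    simp only [atomsOfList, AtomList.OK]
    exact ⟨h e (by simp), ih fun e' he' => h e' (by simp [he'])⟩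

mutual
theorem OKF_mono {𝒢 ℋ : Set (UGraph ℕ)} (h : 𝒢 ⊆ ℋ) : ∀ φ : PDLFormula,
    φ.OK false false true 𝒢 → φ.OK false false true ℋ
  | .prop _ => by simp [PDLFormula.OK]
  | .neg φ => by
    simp only [PDLFormula.OK]; exact fun a => ⟨a.1, OKF_mono h φ a.2⟩
  | .conj φ ψ => by
    simp only [PDLFormula.OK]; exact fun a => ⟨OKF_mono h φ a.1, OKF_mono h ψ a.2⟩
  | .diam π => by
    simp only [PDLFormula.OK]; exact OKP_mono h π
  | .floop π => by simp [PDLFormula.OK]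
theorem OKP_mono {𝒢 ℋ : Set (UGraph ℕ)} (h : 𝒢 ⊆ ℋ) : ∀ π : PDLProgram,
    π.OK false false true 𝒢 → π.OK false false true ℋ
  | .eps => by simp [PDLProgram.OK]
  | .atom _ => by simp [PDLProgram.OK]
  | .conv _ => by simp [PDLProgram.OK]
  | .punion π ρ => by
    simp only [PDLProgram.OK]; exact fun a => ⟨OKP_mono h π a.1, OKP_mono h ρ a.2⟩
  | .comp π ρ => by
    simp only [PDLProgram.OK]; exact fun a => ⟨OKP_mono h π a.1, OKP_mono h ρ a.2⟩
  | .star π => by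
    simp only [PDLProgram.OK]; exact OKP_mono h π
  | .test φ => by
    simp only [PDLProgram.OK]; exact OKF_mono h φ
  | .inter π ρ => by simp [PDLProgram.OK]
  | .cprog C xs xt => by
    simp only [PDLProgram.OK]
    rintro ⟨h1, h2, h3, ⟨H, hH, hi⟩, h5⟩
    exact ⟨h1, h2, h3, ⟨H, h hH, hi⟩, OKA_mono h C h5⟩
theorem OKA_mono {𝒢 ℋ : Set (UGraph ℕ)} (h : 𝒢 ⊆ ℋ) : ∀ C : AtomList,
    C.OK false false true 𝒢 → C.OK false false true ℋ
  | .nil => by simp [AtomList.OK]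
  | .acons π x y C => by
    simp only [AtomList.OK]; exact fun a => ⟨OKP_mono h π a.1, OKA_mono h C a.2⟩
end

theorem TWClass_mono (k : ℕ) : TWClass k ⊆ TWClass (k+1) := by
  rintro G ⟨h1, td, h2⟩
  exact ⟨h1, td, fun b => ⟨(h2 b).1, (h2 b).2.trans (by omega)⟩⟩

/-- Worlds of the CFI structure: side, vertex, edge labelling. -/
abbrev CW (k : ℕ) : Type := ZMod 2 × Fin (k+2) × (Fin (k+2) → ZMod 2)

def cdel {k : ℕ} (r u : Fin (k+2)) : ZMod 2 := if u = r then 1 else 0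

def cgood {k : ℕ} (w : CW k) : Prop :=
  w.2.2 w.2.1 = 0 ∧ ∑ v, w.2.2 v = cdel 0 w.2.1 * w.1

def CK (k : ℕ) : Kripke (CW k) ℕ ℕ where
  rel _ w w' := w.1 = w'.1 ∧ w.2.1 ≠ w'.2.1 ∧ w.2.2 w'.2.1 = w'.2.2 w.2.1 ∧ cgood w ∧ cgood w'
  val _ _ := False

abbrev CG (k : ℕ) : Type := Fin (k+2) → Fin (k+2) → ZMod 2

def cth {k : ℕ} (g : CG k) (w : CW k) : CW k := (w.1 + 1, w.2.1, w.2.2 + g w.2.1)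

def cvalid {k : ℕ} (g : CG k) (r : Fin (k+2)) : Prop :=
  (∀ u v, g u v = g v u) ∧ (∀ u, g u u = 0) ∧ ∀ u, ∑ v, g u v = cdel 0 u + cdel r u

def cedge {k : ℕ} (r s : Fin (k+2)) : CG k := fun u v => cdel r u * cdel s v + cdel s u * cdel r v

theorem two_zero : (2 : ZMod 2) = 0 := rfl

theorem cedge_comm {k : ℕ} (r s : Fin (k+2)) : cedge r s = cedge s r := by
  funext u v; simp only [cedge]; ring

theorem cedge_away {k : ℕ} {r s u : Fin (k+2)} (h1 : u ≠ r) (h2 : u ≠ s) : cedge r s u = 0 := by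
  funext v; simp [cedge, cdel, h1, h2]

theorem sum_cdel {k : ℕ} (r : Fin (k+2)) : ∑ v, cdel r v = 1 := by
  simp [cdel]

theorem cvalid_switch {k : ℕ} {g : CG k} {r : Fin (k+2)} (h : cvalid g r) (s : Fin (k+2)) :
    cvalid (g + cedge r s) s := by
  obtain ⟨h1, h2, h3⟩ := h
  refine ⟨fun u v => ?_, fun u => ?_, fun u => ?_⟩
  · simp only [Pi.add_apply, h1 u v, cedge]; ring
  · simp only [Pi.add_apply, h2, cedge]; linear_combination cdel r u * cdel s u * two_zero
  · simp only [Pi.add_apply, cedge, Finset.sum_add_distrib, ← Finset.mul_sum, sum_cdel, h3]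
    linear_combination cdel r u * two_zero

theorem cth_cth {k : ℕ} (g : CG k) (w : CW k) : cth g (cth g w) = w := by
  obtain ⟨b, u, S⟩ := w
  simp only [cth, Prod.mk.injEq, true_and]
  refine ⟨by linear_combination two_zero, ?_⟩
  funext v
  simp only [Pi.add_apply]
  linear_combination g u v * two_zero

theorem cth_vert {k : ℕ} (g : CG k) (w : CW k) : (cth g w).2.1 = w.2.1 := rfl

theorem cth_congr {k : ℕ} {g g' : CG k} {w : CW k} (h : g w.2.1 = g' w.2.1) :
    cth g w = cth g' w := by
  simp [cth, h]

theorem cth_switch {k : ℕ} (g : CG k) {w : CW k} {r s : Fin (k+2)} (h1 : w.2.1 ≠ r)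
    (h2 : w.2.1 ≠ s) : cth (g + cedge r s) w = cth g w := by
  apply cth_congr
  simp [cedge_away h1 h2]

theorem cgood_cth {k : ℕ} {g : CG k} {r : Fin (k+2)} (h : cvalid g r) {w : CW k}
    (hw : w.2.1 ≠ r) (hg : cgood w) : cgood (cth g w) := by
  obtain ⟨h1, h2, h3⟩ := h
  refine ⟨?_, ?_⟩
  · simp [cth, h2, hg.1]
  · simp only [cth, Pi.add_apply, Finset.sum_add_distrib, h3, hg.2]
    have : cdel r w.2.1 = 0 := by simp [cdel, hw]
    rw [this]; ring

theorem CK_rel_cth {k : ℕ} {g : CG k} {r : Fin (k+2)} (h : cvalid g r) {a : ℕ} {w w' : CW k}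
    (hw : w.2.1 ≠ r) (hw' : w'.2.1 ≠ r) (hr : (CK k).rel a w w') :
    (CK k).rel a (cth g w) (cth g w') := by
  obtain ⟨h1, h2, h3, h4, h5⟩ := hr
  refine ⟨?_, h2, ?_, cgood_cth h hw h4, cgood_cth h hw' h5⟩
  · simp [cth, h1]
  · simp [cth, h3, h.1 w.2.1 w'.2.1]

/-- Invariance for formulas. -/
def FInv (k : ℕ) (φ : PDLFormula) : Prop :=
  ∀ (g : CG k) (r : Fin (k+2)), cvalid g r → ∀ w : CW k, w.2.1 ≠ r →
    φ.sat (CK k) w → φ.sat (CK k) (cth g w)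

/-- Invariance for programs. -/
def PInv (k : ℕ) (π : PDLProgram) : Prop :=
  ∀ (g : CG k) (r : Fin (k+2)), cvalid g r → ∀ w w' : CW k, w.2.1 ≠ r → w'.2.1 ≠ r →
    π.rel (CK k) w w' → π.rel (CK k) (cth g w) (cth g w')

theorem exists_avoid {k : ℕ} (s : Finset (Fin (k+2))) (h : s.card < k + 2) : ∃ r, r ∉ s := by
  by_contra hc
  push Not at hc
  have : s = Finset.univ := Finset.eq_univ_iff_forall.2 hc
  rw [this] at h
  simp at h

theorem PInv_step {k : ℕ} (hk : 2 ≤ k) {P Q : CW k → CW k → Prop}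
    {u w v : CW k}
    (hP : ∀ (g : CG k) (r : Fin (k+2)), cvalid g r → u.2.1 ≠ r → w.2.1 ≠ r →
      P (cth g u) (cth g w))
    (hQ : ∀ (g : CG k) (r : Fin (k+2)), cvalid g r → w.2.1 ≠ r → v.2.1 ≠ r →
      Q (cth g w) (cth g v))
    (g : CG k) (r : Fin (k+2)) (hg : cvalid g r) (hu : u.2.1 ≠ r) (hv : v.2.1 ≠ r) :
    ∃ w', P (cth g u) w' ∧ Q w' (cth g v) := by
  obtain ⟨s, hs⟩ := exists_avoid ({u.2.1, w.2.1, v.2.1} : Finset (Fin (k+2)))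
    (lt_of_le_of_lt Finset.card_le_three (by omega))
  simp only [Finset.mem_insert, Finset.mem_singleton, not_or] at hs
  obtain ⟨h1, h2, h3⟩ := hs
  have hv' := cvalid_switch hg s
  have := hP _ _ hv' (Ne.symm h1) (Ne.symm h2)
  have := hQ _ _ hv' (Ne.symm h2) (Ne.symm h3)
  rw [cth_switch g hu (Ne.symm h1)] at *
  rw [cth_switch g hv (Ne.symm h3)] at *
  exact ⟨_, by assumption, by assumption⟩

/-- sum of edges along a walk -/
def wsum {k : ℕ} {ι : Type} {T : SimpleGraph ι} (r : ι → Fin (k+2)) {a b : ι}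
    (p : T.Walk a b) : CG k :=
  (p.darts.map (fun d => cedge (r d.fst) (r d.snd))).sum

theorem wsum_valid {k : ℕ} {ι : Type} {T : SimpleGraph ι} (r : ι → Fin (k+2)) {a b : ι}
    (p : T.Walk a b) : ∀ (g : CG k), cvalid g (r a) → cvalid (g + wsum r p) (r b) := by
  induction p with
  | nil => intro g hg; simpa [wsum] using hg
  | cons h p ih =>
    intro g hg
    have := ih _ (cvalid_switch hg _)
    simpa [wsum, add_assoc] using this

theorem wsum_concat {k : ℕ} {ι : Type} {T : SimpleGraph ι} (r : ι → Fin (k+2)) {a b c : ι}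
    (p : T.Walk a b) (h : T.Adj b c) :
    wsum r (p.concat h) = wsum r p + cedge (r b) (r c) := by
  simp [wsum, SimpleGraph.Walk.darts_concat]

theorem tree_labels {k : ℕ} {ι : Type} {T : SimpleGraph ι} (hT : T.IsTree) (r : ι → Fin (k+2))
    (a : ι) (g : CG k) (hg : cvalid g (r a)) :
    ∃ G : ι → CG k, G a = g ∧ (∀ b, cvalid (G b) (r b)) ∧
      ∀ b c, T.Adj b c → ∀ u, u ≠ r b → u ≠ r c → G b u = G c u := by
  choose p hp hu using hT.existsUnique_path a
  refine ⟨fun b => g + wsum r (p b), ?_, fun b => wsum_valid r (p b) g hg, ?_⟩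
  · have : p a = SimpleGraph.Walk.nil := (hu a _ (by simp)).symm
    simp [this, wsum]
  · intro b c hbc u hb hc
    by_cases hs : b ∈ (p c).support
    · have := hT.isAcyclic.path_concat (hp b) (hp c) hbc hs
      simp [this, wsum_concat, cedge_away hb hc]
    · have hs := hT.isAcyclic.mem_support_of_ne_mem_support_of_adj_of_isPath (hp b) (hp c) hbc hs
      have := hT.isAcyclic.path_concat (hp c) (hp b) hbc.symm hs
      simp [this, wsum_concat, cedge_away hc hb]

theorem PInv_cprog {k : ℕ} (C : AtomList) (xs xt : ℕ) (hxs : xs ∈ C.vars) (hxt : xt ∈ C.vars)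
    (hH : ∃ H ∈ TWClass k, (cprogGraph C xs xt).Iso H)
    (hC : ∀ e ∈ C.toList, PInv k e.1) : PInv k (.cprog C xs xt) := by
  intro g r hg w w' hw hw'
  simp only [PDLProgram.rel, atomList_sat_iff]
  rintro ⟨f, rfl, rfl, hf⟩
  obtain ⟨H, ⟨-, td, htd⟩, m, hm, hadj⟩ := hH
  have hinj : Set.InjOn m C.vars := hm.injOn
  -- bags pulled back
  let B : td.ι → Set ℕ := fun b => {x | x ∈ C.vars ∧ m x ∈ td.bag b}
  have hBfin : ∀ b, (B b).Finite := fun b =>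
    Set.Finite.of_injOn (f := m) (t := td.bag b) (fun x hx => hx.2)
      (hinj.mono fun x hx => hx.1) (htd b).1
  have hBcard : ∀ b, (B b).ncard ≤ k + 1 := fun b =>
    (Set.ncard_le_ncard_of_injOn m (fun x hx => hx.2)
      (hinj.mono fun x hx => hx.1) (htd b).1).trans (htd b).2
  have hr : ∀ b, ∃ s : Fin (k+2), ∀ x ∈ B b, (f x).2.1 ≠ s := by
    intro b
    obtain ⟨s, hs⟩ := exists_avoid ((hBfin b).toFinset.image fun x => (f x).2.1) (by
      refine lt_of_le_of_lt Finset.card_image_le ?_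
      rw [← Set.ncard_eq_toFinset_card _ (hBfin b)]
      have := hBcard b
      omega)
    refine ⟨s, fun x hx he => hs ?_⟩
    simp only [Finset.mem_image, Set.Finite.mem_toFinset]
    exact ⟨x, hx, he⟩
  choose rr hrr using hr
  have hedge : ∀ x ∈ C.vars, ∀ y ∈ C.vars, (cprogGraph C xs xt).adj x y →
      ∃ b, x ∈ B b ∧ y ∈ B b := by
    intro x hx y hy h
    obtain ⟨b, h1, h2⟩ := td.cov_edge _ _ ((hadj x hx y hy).1 h)
    exact ⟨b, ⟨hx, h1⟩, ⟨hy, h2⟩⟩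
  obtain ⟨b0, hs0, ht0⟩ := hedge xs hxs xt hxt (Or.inr (Or.inl ⟨rfl, rfl⟩))
  obtain ⟨G, hG0, hGv, hGadj⟩ := tree_labels td.isTree rr b0 _ (cvalid_switch hg (rr b0))
  have hcoh : ∀ x b b', x ∈ B b → x ∈ B b' → cth (G b) (f x) = cth (G b') (f x) := by
    intro x b b' hb hb'
    have h := td.conn (m x) b b' hb.2 hb'.2
    have hx := hb.1
    clear hb hb'
    induction h with
    | refl => rfl
    | tail _ h ih =>
      rw [ih]
      exact cth_congr (hGadj _ _ h.1 _ (hrr _ x ⟨hx, h.2.1⟩) (hrr _ x ⟨hx, h.2.2⟩))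
  classical
  let f' : ℕ → CW k := fun x => if h : ∃ b, x ∈ B b then cth (G h.choose) (f x) else f x
  have hf' : ∀ x b, x ∈ B b → f' x = cth (G b) (f x) := by
    intro x b hb
    have h : ∃ b, x ∈ B b := ⟨b, hb⟩
    simp only [f', dif_pos h]
    exact hcoh x _ _ h.choose_spec hb
  refine ⟨f', ?_, ?_, ?_⟩
  · rw [hf' xs b0 hs0, hG0, cth_switch g hw (hrr b0 xs hs0)]
  · rw [hf' xt b0 ht0, hG0, cth_switch g hw' (hrr b0 xt ht0)]
  · intro e he
    obtain ⟨b, h1, h2⟩ := hedge e.2.1 ⟨e, he, Or.inl rfl⟩ e.2.2 ⟨e, he, Or.inr rfl⟩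
      (Or.inl ⟨e, he, Or.inl ⟨rfl, rfl⟩⟩)
    rw [hf' _ b h1, hf' _ b h2]
    exact hC e he _ _ (hGv b) _ _ (hrr b _ h1) (hrr b _ h2) (hf e he)

mutual
theorem FInv_of_OK {k : ℕ} (hk : 2 ≤ k) : ∀ φ : PDLFormula,
    φ.OK false false true (TWClass k) → FInv k φ
  | .prop _ => by
    intro _ g r hg w hw
    simp [PDLFormula.sat, CK]
  | .neg φ => by
    simp only [PDLFormula.OK]
    rintro ⟨-, h⟩ g r hg w hw
    simp only [PDLFormula.sat]
    intro h1 h2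
    have := FInv_of_OK hk φ h g r hg (cth g w) hw h2
    rw [cth_cth] at this
    exact h1 this
  | .conj φ ψ => by
    simp only [PDLFormula.OK]
    rintro ⟨h1, h2⟩ g r hg w hw
    simp only [PDLFormula.sat]
    exact fun h => ⟨FInv_of_OK hk φ h1 g r hg w hw h.1, FInv_of_OK hk ψ h2 g r hg w hw h.2⟩
  | .diam π => by
    simp only [PDLFormula.OK]
    intro h g r hg w hw
    simp only [PDLFormula.sat]
    rintro ⟨v, hv⟩
    have ih := PInv_of_OK hk π h
    obtain ⟨w', h1, -⟩ := PInv_step hk (P := fun a b => π.rel (CK k) a b) (Q := fun _ _ => True)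
      (u := w) (w := v) (v := w) (fun g r hg h1 h2 => ih g r hg w v h1 h2 hv)
      (fun _ _ _ _ _ => trivial) g r hg hw hw
    exact ⟨w', h1⟩
  | .floop π => by simp [PDLFormula.OK]
theorem PInv_of_OK {k : ℕ} (hk : 2 ≤ k) : ∀ π : PDLProgram,
    π.OK false false true (TWClass k) → PInv k π
  | .eps => by
    intro _ g r hg w w' hw hw'
    simp only [PDLProgram.rel]
    rintro rfl; rfl
  | .atom _ => by
    intro _ g r hg w w' hw hw'
    simp only [PDLProgram.rel]
    exact CK_rel_cth hg hw hw'
  | .conv _ => by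
    intro _ g r hg w w' hw hw'
    simp only [PDLProgram.rel]
    exact CK_rel_cth hg hw' hw
  | .punion π ρ => by
    simp only [PDLProgram.OK]
    rintro ⟨h1, h2⟩ g r hg w w' hw hw'
    simp only [PDLProgram.rel]
    exact Or.imp (PInv_of_OK hk π h1 g r hg w w' hw hw') (PInv_of_OK hk ρ h2 g r hg w w' hw hw')
  | .comp π ρ => by
    simp only [PDLProgram.OK]
    rintro ⟨h1, h2⟩ g r hg w w' hw hw'
    simp only [PDLProgram.rel]
    rintro ⟨v, hv1, hv2⟩
    have ih1 := PInv_of_OK hk π h1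
    have ih2 := PInv_of_OK hk ρ h2
    exact PInv_step hk (P := fun a b => π.rel (CK k) a b) (Q := fun a b => ρ.rel (CK k) a b)
      (fun g r hg a b => ih1 g r hg _ _ a b hv1) (fun g r hg a b => ih2 g r hg _ _ a b hv2)
      g r hg hw hw'
  | .star π => by
    simp only [PDLProgram.OK]
    intro h g r hg w w' hw hw'
    have ih := PInv_of_OK hk π h
    simp only [PDLProgram.rel]
    intro hs
    induction hs using Relation.ReflTransGen.head_induction_on generalizing g r with
    | refl => exact Relation.ReflTransGen.refl
    | head hab _ ihs =>
      obtain ⟨x, h1, h2⟩ := PInv_step hk (P := fun a b => π.rel (CK k) a b)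
        (Q := fun a b => Relation.ReflTransGen (fun a b => π.rel (CK k) a b) a b)
        (fun g r hg a b => ih g r hg _ _ a b hab)
        (fun g r hg a b => ihs g r hg a b)
        g r hg hw hw'
      exact Relation.ReflTransGen.head h1 h2
  | .test φ => by
    simp only [PDLProgram.OK]
    intro h g r hg w w' hw hw'
    simp only [PDLProgram.rel]
    rintro ⟨rfl, h1⟩
    exact ⟨rfl, FInv_of_OK hk φ h g r hg w hw h1⟩
  | .inter π ρ => by simp [PDLProgram.OK]
  | .cprog C xs xt => by
    simp only [PDLProgram.OK]
    rintro ⟨h1, h2, h3, h4, h5⟩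
    exact PInv_cprog C xs xt h1 h2 h4 (AInv_of_OK hk C h5)
theorem AInv_of_OK {k : ℕ} (hk : 2 ≤ k) : ∀ C : AtomList,
    C.OK false false true (TWClass k) → ∀ e ∈ C.toList, PInv k e.1
  | .nil => by simp [AtomList.toList]
  | .acons π x y C => by
    simp only [AtomList.OK, AtomList.toList, List.mem_cons]
    rintro ⟨h1, h2⟩ e (rfl | he)
    · exact PInv_of_OK hk π h1
    · exact AInv_of_OK hk C h2 e he
end

/-- The atoms of the clique program. -/
def cliqueAtoms (n : ℕ) : List (PDLProgram × ℕ × ℕ) :=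
  ((List.range n ×ˢ List.range n).filter (fun p => p.1 ≠ p.2)).map
    (fun p => (PDLProgram.atom 0, p.1, p.2))

theorem mem_cliqueAtoms (n : ℕ) (e : PDLProgram × ℕ × ℕ) :
    e ∈ cliqueAtoms n ↔ ∃ i j, i < n ∧ j < n ∧ i ≠ j ∧ e = (PDLProgram.atom 0, i, j) := by
  simp only [cliqueAtoms, List.mem_map, List.mem_filter, List.mem_product, List.mem_range,
    Prod.exists, decide_eq_true_eq]
  constructor
  · rintro ⟨i, j, ⟨⟨h1, h2⟩, h3⟩, rfl⟩
    exact ⟨i, j, h1, h2, h3, rfl⟩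
  · rintro ⟨i, j, h1, h2, h3, rfl⟩
    exact ⟨i, j, ⟨⟨h1, h2⟩, h3⟩, rfl⟩

def cliqueC (k : ℕ) : AtomList := atomsOfList (cliqueAtoms (k+2))

theorem cliqueC_mem (k : ℕ) (e : PDLProgram × ℕ × ℕ) :
    e ∈ (cliqueC k).toList ↔
      ∃ i j, i < k+2 ∧ j < k+2 ∧ i ≠ j ∧ e = (PDLProgram.atom 0, i, j) := by
  rw [cliqueC, toList_atomsOfList, mem_cliqueAtoms]

theorem cliqueC_vars (k : ℕ) : (cliqueC k).vars = {i | i < k+2} := by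
  ext z
  simp only [AtomList.vars, Set.mem_setOf_eq, cliqueC_mem]
  constructor
  · rintro ⟨e, ⟨i, j, hi, hj, hij, rfl⟩, rfl | rfl⟩
    · exact hi
    · exact hj
  · intro hz
    by_cases h : z = 0
    · exact ⟨_, ⟨0, 1, by omega, by omega, by omega, rfl⟩, Or.inl h⟩
    · exact ⟨_, ⟨z, 0, hz, by omega, h, rfl⟩, Or.inl rfl⟩

theorem clique_OK (k : ℕ) :
    (PDLFormula.diam (.cprog (cliqueC k) 0 0)).OK false false true (TWClass (k+1)) := by
  simp only [PDLFormula.OK, PDLProgram.OK]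
  have h0 : 0 ∈ (cliqueC k).vars := by simp [cliqueC_vars]
  refine ⟨h0, h0, ⟨⟨0, h0⟩, ?_⟩, ⟨cprogGraph (cliqueC k) 0 0, ⟨?_, ?_⟩, id, ?_, ?_⟩, ?_⟩
  · intro x hx y hy
    change x ∈ (cliqueC k).vars at hx
    change y ∈ (cliqueC k).vars at hy
    rw [cliqueC_vars] at hx hy
    by_cases h : x = y
    · subst h; exact Relation.ReflTransGen.refl
    · exact Relation.ReflTransGen.single
        ⟨_, (cliqueC_mem k _).2 ⟨x, y, hx, hy, h, rfl⟩, Or.inl ⟨rfl, rfl⟩⟩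
  · change (cliqueC k).vars.Finite
    rw [cliqueC_vars]; exact Set.finite_lt_nat _
  · refine ⟨⟨Unit, ⊥, SimpleGraph.IsTree.of_subsingleton, fun _ => (cliqueC k).vars,
      fun v hv => ⟨(), hv⟩, ?_, fun v b b' _ _ => Relation.ReflTransGen.refl⟩, ?_⟩
    · rintro x y (⟨e, he, ⟨rfl, rfl⟩ | ⟨rfl, rfl⟩⟩ | ⟨rfl, rfl⟩ | ⟨rfl, rfl⟩)
      · exact ⟨(), ⟨e, he, Or.inl rfl⟩, ⟨e, he, Or.inr rfl⟩⟩
      · exact ⟨(), ⟨e, he, Or.inr rfl⟩, ⟨e, he, Or.inl rfl⟩⟩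
      · exact ⟨(), h0, h0⟩
      · exact ⟨(), h0, h0⟩
    · intro b
      change (cliqueC k).vars.Finite ∧ (cliqueC k).vars.ncard ≤ k + 1 + 1
      have : (cliqueC k).vars = ((Finset.range (k+2) : Finset ℕ) : Set ℕ) := by
        rw [cliqueC_vars]; ext; simp
      rw [this]
      exact ⟨Finset.finite_toSet _, by rw [Set.ncard_coe_finset]; simp⟩
  · exact Set.bijOn_id _
  · intro x _ y _; rfl
  · apply atomList_OK_atomsOfList
    intro e he
    obtain ⟨i, j, -, -, -, rfl⟩ := (mem_cliqueAtoms _ _).1 he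
    simp [PDLProgram.OK]

theorem clique_sat_iff (k : ℕ) (w : CW k) :
    (PDLFormula.diam (.cprog (cliqueC k) 0 0)).sat (CK k) w ↔
      ∃ f : ℕ → CW k, f 0 = w ∧ ∀ i j, i < k+2 → j < k+2 → i ≠ j → (CK k).rel 0 (f i) (f j) := by
  simp only [PDLFormula.sat, PDLProgram.rel, atomList_sat_iff, cliqueC_mem]
  constructor
  · rintro ⟨v, f, h1, -, h2⟩
    refine ⟨f, h1, fun i j hi hj hij => ?_⟩
    have := h2 _ ⟨i, j, hi, hj, hij, rfl⟩
    simpa only [PDLProgram.rel] using this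
  · rintro ⟨f, h1, h2⟩
    refine ⟨w, f, h1, h1, ?_⟩
    rintro e ⟨i, j, hi, hj, hij, rfl⟩
    simp only [PDLProgram.rel]
    exact h2 i j hi hj hij

theorem clique_sat_zero (k : ℕ) :
    (PDLFormula.diam (.cprog (cliqueC k) 0 0)).sat (CK k) (0, 0, 0) := by
  rw [clique_sat_iff]
  refine ⟨fun i => (0, Fin.ofNat (k+2) i, 0), rfl, ?_⟩
  intro i j hi hj hij
  have hgood : ∀ u : Fin (k+2), cgood ((0, u, 0) : CW k) := fun u => by simp [cgood]
  refine ⟨rfl, ?_, rfl, hgood _, hgood _⟩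
  intro h
  apply hij
  have := congrArg Fin.val h
  simpa [Fin.ofNat, Nat.mod_eq_of_lt hi, Nat.mod_eq_of_lt hj] using this

theorem sum_symm_zero {n : ℕ} (M : Fin n → Fin n → ZMod 2) (hs : ∀ i j, i ≠ j → M i j = M j i)
    (hd : ∀ i, M i i = 0) : ∑ i, ∑ j, M i j = 0 := by
  rw [← Finset.sum_product' Finset.univ Finset.univ M]
  refine Finset.sum_involution (fun a _ => (a.2, a.1)) ?_ ?_ ?_ ?_
  · rintro ⟨i, j⟩ _
    by_cases h : i = j
    · subst h; simp [hd]
    · simp only [hs i j h]; linear_combination M j i * two_zero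
  · rintro ⟨i, j⟩ _ h he
    simp only [Prod.mk.injEq] at he
    obtain ⟨rfl, -⟩ := he
    exact h (hd _)
  · intros; simp
  · intros; simp

theorem clique_not_sat_one (k : ℕ) (w : CW k) (hw : w.1 = 1) :
    ¬ (PDLFormula.diam (.cprog (cliqueC k) 0 0)).sat (CK k) w := by
  rw [clique_sat_iff]
  rintro ⟨f, h0, hf⟩
  have hrel : ∀ i j : Fin (k+2), i ≠ j → (CK k).rel 0 (f i) (f j) := fun i j hij =>
    hf i j i.2 j.2 (fun h => hij (Fin.ext h))
  let h : Fin (k+2) → Fin (k+2) := fun i => (f i).2.1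
  have hinj : Function.Injective h := by
    intro i j hij
    by_contra hne
    exact (hrel i j hne).2.1 hij
  have hbij : Function.Bijective h := Finite.injective_iff_bijective.1 hinj
  have hgood : ∀ i : Fin (k+2), cgood (f i) := by
    intro i
    obtain ⟨j, hj⟩ := exists_ne i
    exact (hrel i j hj.symm).2.2.2.1
  have hb : ∀ i : Fin (k+2), (f i).1 = 1 := by
    intro i
    by_cases hi : i = 0
    · subst hi; rw [← hw, ← h0]; rfl
    · rw [(hrel i 0 hi).1, ← hw, ← h0]; rfl
  have hsum := sum_symm_zero (fun i j => (f i).2.2 (h j))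
    (fun i j hij => (hrel i j hij).2.2.1) (fun i => (hgood i).1)
  have hrow : ∀ i : Fin (k+2), ∑ j, (f i).2.2 (h j) = cdel 0 (h i) := by
    intro i
    rw [hbij.sum_comp (fun v => (f i).2.2 v), (hgood i).2, hb i, mul_one]
  simp only [hrow] at hsum
  rw [hbij.sum_comp (fun v => cdel 0 v), sum_cdel] at hsum
  exact one_ne_zero hsum

/-- Theorem 4 of the paper: for every `k ≥ 2`, `CPDL(TWₖ)` is strictly
less expressive than `CPDL(TW_{k+1})`. -/
theorem tw_hierarchy_strict (k : ℕ) (hk : 2 ≤ k) :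
    (∀ φ, PDLFormula.OK false false true (TWClass k) φ →
      ∃ ψ, PDLFormula.OK false false true (TWClass (k+1)) ψ ∧ FormEquiv φ ψ) ∧
    (∀ π, PDLProgram.OK false false true (TWClass k) π →
      ∃ ρ, PDLProgram.OK false false true (TWClass (k+1)) ρ ∧ ProgEquiv π ρ) ∧
    (∃ φ, PDLFormula.OK false false true (TWClass (k+1)) φ ∧
      ∀ ψ, PDLFormula.OK false false true (TWClass k) ψ → ¬ FormEquiv φ ψ) := by
  refine ⟨fun φ h => ⟨φ, OKF_mono (TWClass_mono k) φ h, fun _ _ _ => Iff.rfl⟩,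
    fun π h => ⟨π, OKP_mono (TWClass_mono k) π h, fun _ _ _ _ => Iff.rfl⟩,
    _, clique_OK k, ?_⟩
  intro ψ hψ heq
  have hv0 : cvalid (0 : CG k) 0 := by
    refine ⟨fun _ _ => rfl, fun _ => rfl, fun u => ?_⟩
    simp only [Pi.zero_apply, Finset.sum_const_zero]
    linear_combination -(cdel 0 u) * two_zero
  have hv := cvalid_switch hv0 1
  have h1 := (heq _ (CK k) (0, 0, 0)).1 (clique_sat_zero k)
  have h2 := FInv_of_OK hk ψ hψ _ _ hv (0, 0, 0) (by simp) h1
  exact clique_not_sat_one k _ (by simp [cth]) ((heq _ (CK k) _).2 h2)
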